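/- arXiv:1403.0150 — 2 statements merged into one kernel-verified Lean document; each statement's English description precedes it below -/
import Mathlib

section
/- Let F = (F_1, …, F_m) : ℝⁿ → ℝᵐ have each component F_i locally Lipschitz on ℝⁿ and quasiconvex. Let {x^k} be an SPPM sequence with parameters satisfying 0 < α_k < ᾱ for some ᾱ > 0, ‖e_k‖ = 1 and ‖z_k‖ = 1 for all k. If lim_{k→∞} ‖x^{k+1} − x^k‖ = 0 and {x^k} has a cluster point x̂, then x̂ is a Pareto-Clarke critical point of the problem min{F(x) : x ∈ ℝⁿ}. -/
open Filter Metric Set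
open scoped Topology RealInnerProductSpace Pointwise

/-- The Clarke directional derivative of `f` at `x` in the direction `d`. -/
noncomputable def clarkeDeriv {n : ℕ} (f : EuclideanSpace ℝ (Fin n) → ℝ)
    (x d : EuclideanSpace ℝ (Fin n)) : ℝ :=
  Filter.limsup (fun p : EuclideanSpace ℝ (Fin n) × ℝ => (f (p.1 + p.2 • d) - f p.1) / p.2)
    ((𝓝 x) ×ˢ (𝓝[>] (0 : ℝ)))

/-- The Clarke subdifferential of `f` at `x`. -/
def clarkeSubdiff {n : ℕ} (f : EuclideanSpace ℝ (Fin n) → ℝ) (x : EuclideanSpace ℝ (Fin n)) :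
    Set (EuclideanSpace ℝ (Fin n)) :=
  {w | ∀ d, ⟪w, d⟫ ≤ clarkeDeriv f x d}

/-- The normal cone to `D` at `x`. -/
def normalCone {n : ℕ} (D : Set (EuclideanSpace ℝ (Fin n))) (x : EuclideanSpace ℝ (Fin n)) :
    Set (EuclideanSpace ℝ (Fin n)) :=
  {v | ∀ y ∈ D, ⟪v, y - x⟫ ≤ 0}

/-- `f` is locally Lipschitz on `ℝⁿ`. -/
def LocLipOn {n : ℕ} (f : EuclideanSpace ℝ (Fin n) → ℝ) : Prop :=
  ∀ x, ∃ ε > (0 : ℝ), ∃ L > (0 : ℝ),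
    ∀ z ∈ ball x ε, ∀ y ∈ ball x ε, |f z - f y| ≤ L * ‖z - y‖

/-- `f` is quasiconvex. -/
def QuasiconvexFun {n : ℕ} (f : EuclideanSpace ℝ (Fin n) → ℝ) : Prop :=
  ∀ x y, ∀ t ∈ Set.Icc (0 : ℝ) 1, f (t • x + (1 - t) • y) ≤ max (f x) (f y)

/-- An SPPM sequence for `F` with parameters `α`, `e`, `z`: for every `k`,
`x^{k+1} ∈ Ω_k = {x : F(x) ⪯ F(x^k)}` and `0 ∈ ∂°h_k(x^{k+1}) + N_{Ω_k}(x^{k+1})`,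
where `h_k(x) = ⟨F(x), z_k⟩ + (α_k/2)⟨e_k, z_k⟩‖x − x^k‖²`. -/
def SPPMSeq {n m : ℕ} (F : Fin m → EuclideanSpace ℝ (Fin n) → ℝ)
    (x : ℕ → EuclideanSpace ℝ (Fin n)) (α : ℕ → ℝ)
    (e z : ℕ → EuclideanSpace ℝ (Fin m)) : Prop :=
  (∀ k, 0 < α k) ∧ (∀ k i, 0 < e k i) ∧ (∀ k i, 0 ≤ z k i) ∧ (∀ k, z k ≠ 0) ∧
  (∀ k, (∀ i, F i (x (k + 1)) ≤ F i (x k)) ∧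
    (0 : EuclideanSpace ℝ (Fin n)) ∈
      clarkeSubdiff
        (fun y => (∑ i, z k i * F i y) + α k / 2 * (∑ i, e k i * z k i) * ‖y - x k‖ ^ 2)
        (x (k + 1)) +
      normalCone {y : EuclideanSpace ℝ (Fin n) | ∀ i, F i y ≤ F i (x k)} (x (k + 1)))

/-- The difference quotients of a locally Lipschitz function are locally bounded. -/
theorem LocLipOn.eventually_abs_quotient_le {n : ℕ} {f : EuclideanSpace ℝ (Fin n) → ℝ}
    (hf : LocLipOn f) (x d : EuclideanSpace ℝ (Fin n)) :
    ∃ C : ℝ, ∀ᶠ p : EuclideanSpace ℝ (Fin n) × ℝ in (𝓝 x) ×ˢ (𝓝[>] (0 : ℝ)),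
      |(f (p.1 + p.2 • d) - f p.1) / p.2| ≤ C := by
  obtain ⟨ε, hε, L, hL, h⟩ := hf x
  refine ⟨L * ‖d‖, ?_⟩
  have hle : (𝓝 x) ×ˢ (𝓝[>] (0 : ℝ)) ≤ 𝓝 (x, (0 : ℝ)) := by
    rw [nhds_prod_eq]
    exact Filter.prod_mono le_rfl nhdsWithin_le_nhds
  have hcont : Continuous fun p : EuclideanSpace ℝ (Fin n) × ℝ => p.1 + p.2 • d := by fun_prop
  have hball : ball x ε ∈ 𝓝 x := ball_mem_nhds x hε
  have h1 : ∀ᶠ p in (𝓝 x) ×ˢ (𝓝[>] (0 : ℝ)), p.1 + p.2 • d ∈ ball x ε :=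
    hle (hcont.continuousAt.eventually_mem (by simpa using hball))
  have h2 : ∀ᶠ p in (𝓝 x) ×ˢ (𝓝[>] (0 : ℝ)), p.1 ∈ ball x ε :=
    tendsto_fst.eventually_mem hball
  have h3 : ∀ᶠ p in (𝓝 x) ×ˢ (𝓝[>] (0 : ℝ)), p.2 ∈ Ioi (0 : ℝ) :=
    tendsto_snd.eventually_mem self_mem_nhdsWithin
  filter_upwards [h1, h2, h3] with p hp1 hp2 (hp3 : 0 < p.2)
  rw [abs_div, abs_of_pos hp3, div_le_iff₀ hp3]
  refine (h _ hp1 _ hp2).trans_eq ?_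
  rw [add_sub_cancel_left, norm_smul, Real.norm_of_nonneg hp3.le]
  ring

/-- A negative upper bound on the Clarke derivative of a locally Lipschitz function bounds its
difference quotients nearby. -/
theorem LocLipOn.eventually_quotient_lt {n : ℕ} {f : EuclideanSpace ℝ (Fin n) → ℝ}
    (hf : LocLipOn f) {x d : EuclideanSpace ℝ (Fin n)} {a : ℝ} (ha : clarkeDeriv f x d < a) :
    ∀ᶠ p : EuclideanSpace ℝ (Fin n) × ℝ in (𝓝 x) ×ˢ (𝓝[>] (0 : ℝ)),
      (f (p.1 + p.2 • d) - f p.1) / p.2 < a := by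
  obtain ⟨C, hC⟩ := hf.eventually_abs_quotient_le x d
  exact eventually_lt_of_limsup_lt ha ⟨C, hC.mono fun p hp => (abs_le.mp hp).2⟩

theorem clarkeDeriv_le_of_eventually {n : ℕ} {f : EuclideanSpace ℝ (Fin n) → ℝ}
    {x d : EuclideanSpace ℝ (Fin n)} {a b : ℝ}
    (h : ∀ᶠ p : EuclideanSpace ℝ (Fin n) × ℝ in (𝓝 x) ×ˢ (𝓝[>] (0 : ℝ)),
      b ≤ (f (p.1 + p.2 • d) - f p.1) / p.2 ∧ (f (p.1 + p.2 • d) - f p.1) / p.2 ≤ a) :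
    clarkeDeriv f x d ≤ a := by
  refine limsup_le_of_le ?_ (h.mono fun p hp => hp.2)
  have hb : IsBoundedUnder (· ≥ ·) ((𝓝 x) ×ˢ (𝓝[>] (0 : ℝ)))
      fun p : EuclideanSpace ℝ (Fin n) × ℝ => (f (p.1 + p.2 • d) - f p.1) / p.2 :=
    ⟨b, h.mono fun p hp => hp.1⟩
  exact hb.isCoboundedUnder_le

/-- The Clarke derivative of a proximally regularized scalarization is bounded by the
scalarized descent rate plus the contribution of the quadratic term. -/
theorem clarkeDeriv_scalarization_le {n m : ℕ} {F : Fin m → EuclideanSpace ℝ (Fin n) → ℝ}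
    (hlip : ∀ i, LocLipOn (F i)) {ζ : Fin m → ℝ} (hζ : ∀ i, 0 ≤ ζ i) {K c η : ℝ} (hK : 0 ≤ K)
    (hη : 0 < η) (u x d : EuclideanSpace ℝ (Fin n))
    (hF : ∀ᶠ p : EuclideanSpace ℝ (Fin n) × ℝ in (𝓝 x) ×ˢ (𝓝[>] (0 : ℝ)),
      ∀ i, (F i (p.1 + p.2 • d) - F i p.1) / p.2 < -c) :
    clarkeDeriv (fun y => (∑ i, ζ i * F i y) + K * ‖y - u‖ ^ 2) x d
      ≤ -c * (∑ i, ζ i) + K * (2 * (‖x - u‖ * ‖d‖) + η) := by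
  choose C hC using fun i => (hlip i).eventually_abs_quotient_le x d
  have hle : (𝓝 x) ×ˢ (𝓝[>] (0 : ℝ)) ≤ 𝓝 (x, (0 : ℝ)) := by
    rw [nhds_prod_eq]
    exact Filter.prod_mono le_rfl nhdsWithin_le_nhds
  have hcont : Continuous fun p : EuclideanSpace ℝ (Fin n) × ℝ =>
      |2 * ⟪p.1 - u, d⟫ + p.2 * ‖d‖ ^ 2| := by fun_prop
  have hx : |2 * ⟪x - u, d⟫ + 0 * ‖d‖ ^ 2| < 2 * (‖x - u‖ * ‖d‖) + η := by
    rw [zero_mul, add_zero, abs_mul, abs_two]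
    linarith [abs_real_inner_le_norm (x - u) d]
  have hG : ∀ᶠ p in (𝓝 x) ×ˢ (𝓝[>] (0 : ℝ)),
      |2 * ⟪p.1 - u, d⟫ + p.2 * ‖d‖ ^ 2| < 2 * (‖x - u‖ * ‖d‖) + η :=
    hle (hcont.continuousAt.eventually_lt continuousAt_const hx)
  have hpos : ∀ᶠ p in (𝓝 x) ×ˢ (𝓝[>] (0 : ℝ)), p.2 ∈ Ioi (0 : ℝ) :=
    tendsto_snd.eventually_mem self_mem_nhdsWithin
  refine clarkeDeriv_le_of_eventually
    (b := (∑ i, ζ i * -C i) + K * -(2 * (‖x - u‖ * ‖d‖) + η)) ?_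
  filter_upwards [hF, hG, hpos, eventually_all.mpr hC] with p hp1 hp2 (hp3 : 0 < p.2) hp4
  have hq : ((∑ i, ζ i * F i (p.1 + p.2 • d)) + K * ‖p.1 + p.2 • d - u‖ ^ 2
      - ((∑ i, ζ i * F i p.1) + K * ‖p.1 - u‖ ^ 2)) / p.2
      = (∑ i, ζ i * ((F i (p.1 + p.2 • d) - F i p.1) / p.2))
        + K * (2 * ⟪p.1 - u, d⟫ + p.2 * ‖d‖ ^ 2) := by
    have hs : (∑ i, ζ i * ((F i (p.1 + p.2 • d) - F i p.1) / p.2))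
        = ((∑ i, ζ i * F i (p.1 + p.2 • d)) - ∑ i, ζ i * F i p.1) / p.2 := by
      rw [← Finset.sum_sub_distrib, Finset.sum_div]
      exact Finset.sum_congr rfl fun i _ => by ring
    have hn : ‖p.1 + p.2 • d - u‖ ^ 2
        = ‖p.1 - u‖ ^ 2 + 2 * (p.2 * ⟪p.1 - u, d⟫) + p.2 ^ 2 * ‖d‖ ^ 2 := by
      rw [add_sub_right_comm, norm_add_sq_real, real_inner_smul_right, norm_smul, mul_pow,
        Real.norm_eq_abs, sq_abs]
    rw [hs, hn]
    field_simp
    ring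
  obtain ⟨hG1, hG2⟩ := abs_lt.mp hp2
  rw [hq]
  constructor
  · gcongr with i
    · exact hζ i
    · exact (abs_le.mp (hp4 i)).1
  · rw [mul_comm (-c), Finset.sum_mul]
    gcongr with i
    · exact hζ i
    · exact (hp1 i).le

theorem norm_le_sum_of_nonneg {m : ℕ} (z : EuclideanSpace ℝ (Fin m)) (hz : ∀ i, 0 ≤ z i) :
    ‖z‖ ≤ ∑ i, z i := by
  rw [EuclideanSpace.norm_eq]
  refine Real.sqrt_le_iff.mpr ⟨Finset.sum_nonneg fun i _ => hz i, ?_⟩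
  simp only [Real.norm_eq_abs, sq_abs]
  exact Finset.sum_sq_le_sq_sum_of_nonneg fun i _ => hz i

/-- If the consecutive iterates of an SPPM sequence (with bounded parameters) converge to
zero, then any cluster point of the sequence is a Pareto-Clarke critical point of `F`. -/
theorem cluster_point_is_paretoClarke_critical {n m : ℕ}
    (F : Fin m → EuclideanSpace ℝ (Fin n) → ℝ)
    (hlip : ∀ i, LocLipOn (F i)) (hquasi : ∀ i, QuasiconvexFun (F i))
    (x : ℕ → EuclideanSpace ℝ (Fin n)) (α : ℕ → ℝ) (e z : ℕ → EuclideanSpace ℝ (Fin m))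
    (hsppm : SPPMSeq F x α e z)
    (αbar : ℝ) (hαbar : 0 < αbar) (hα : ∀ k, 0 < α k ∧ α k < αbar)
    (hne : ∀ k, ‖e k‖ = 1) (hnz : ∀ k, ‖z k‖ = 1)
    (hstep : Tendsto (fun k => ‖x (k + 1) - x k‖) atTop (𝓝 0))
    (xhat : EuclideanSpace ℝ (Fin n))
    (φ : ℕ → ℕ) (hφ : StrictMono φ) (hlim : Tendsto (x ∘ φ) atTop (𝓝 xhat)) :
    ∀ d : EuclideanSpace ℝ (Fin n), ∃ i, 0 ≤ clarkeDeriv (F i) xhat d := by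
  intro d
  by_contra! hneg
  obtain ⟨-, he, hz, -, hstat⟩ := hsppm
  obtain ⟨c, hcF, hc⟩ : ∃ c : ℝ, (∀ i, clarkeDeriv (F i) xhat d < -c) ∧ 0 < c := by
    have h : ∀ᶠ c : ℝ in 𝓝[>] (0 : ℝ), ∀ i, clarkeDeriv (F i) xhat d < -c :=
      eventually_all.mpr fun i => nhdsWithin_le_nhds <|
        (eventually_lt_nhds (neg_pos.mpr (hneg i))).mono fun c hc => lt_neg_of_lt_neg hc
    exact (h.and self_mem_nhdsWithin).exists
  have hdescent := eventually_all.mpr fun i => (hlip i).eventually_quotient_lt (hcF i)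
  obtain ⟨P, hP, Q, hQ, hPQ⟩ := eventually_prod_iff.mp hdescent
  have hstepφ : Tendsto (fun j => ‖x (φ j + 1) - x (φ j)‖) atTop (𝓝 0) :=
    hstep.comp hφ.tendsto_atTop
  have hlim' : Tendsto (fun j => x (φ j + 1)) atTop (𝓝 xhat) := by
    simpa using (tendsto_zero_iff_norm_tendsto_zero.mpr hstepφ).add hlim
  have hsmall : ∀ᶠ j in atTop, αbar * (‖x (φ j + 1) - x (φ j)‖ * ‖d‖) < c / 4 := by
    have h := (hstepφ.mul_const ‖d‖).const_mul αbar
    rw [zero_mul, mul_zero] at h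
    exact h.eventually_lt_const (by positivity)
  obtain ⟨j, hPj, hsj⟩ := ((hlim'.eventually hP.eventually_nhds).and
    hsmall).exists
  generalize φ j = k at hPj hsj
  obtain ⟨hmono, w, hw, v, hv, hwv⟩ := hstat k
  have hvd : ⟪v, d⟫ ≤ 0 := by
    obtain ⟨t, hQt, ht : 0 < t⟩ := (hQ.and self_mem_nhdsWithin).exists
    have hmem : x (k + 1) + t • d ∈ {y | ∀ i, F i y ≤ F i (x k)} := fun i => by
      have h := hPQ hPj.self_of_nhds hQt i
      rw [div_lt_iff₀ ht] at h
      have := hmono i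
      dsimp only at h
      nlinarith
    have h := hv _ hmem
    rw [add_sub_cancel_left, real_inner_smul_right] at h
    exact nonpos_of_mul_nonpos_right h ht
  have hwd : 0 ≤ ⟪w, d⟫ := by
    have h : ⟪w + v, d⟫ = 0 := by
      rw [show w + v = 0 from hwv, inner_zero_left]
    rw [inner_add_left] at h
    linarith
  have hez0 : 0 ≤ ∑ i, e k i * z k i :=
    Finset.sum_nonneg fun i _ => mul_nonneg (he k i).le (hz k i)
  have hez1 : ∑ i, e k i * z k i ≤ 1 := by
    have h := real_inner_le_norm (z k) (e k)
    rw [hne, hnz, mul_one] at h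
    simpa [PiLp.inner_apply] using h
  have hz1 : 1 ≤ ∑ i, z k i := (hnz k).symm.le.trans (norm_le_sum_of_nonneg _ (hz k))
  have hK0 : 0 ≤ α k / 2 * ∑ i, e k i * z k i := mul_nonneg (by linarith [(hα k).1]) hez0
  have hK : α k / 2 * ∑ i, e k i * z k i ≤ αbar / 2 := by nlinarith [(hα k).1, (hα k).2]
  have hder := clarkeDeriv_scalarization_le hlip (hz k) hK0 (div_pos hc hαbar) (x k) (x (k + 1)) d
    (eventually_prod_iff.mpr ⟨P, hPj, Q, hQ, hPQ⟩)
  have hbound : α k / 2 * (∑ i, e k i * z k i) * (2 * (‖x (k + 1) - x k‖ * ‖d‖) + c / αbar)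
      ≤ αbar * (‖x (k + 1) - x k‖ * ‖d‖) + c / 2 := by
    refine (mul_le_mul_of_nonneg_right hK (by positivity)).trans_eq ?_
    field_simp
  nlinarith [hw d]
end

section
/- Let F = (F_1, …, F_m) : ℝⁿ → ℝᵐ have each component F_i convex (hence locally Lipschitz on ℝⁿ and quasiconvex) and positive, satisfying the completeness assumption (H3) relative to the initial point x⁰, and let {x^k} be an SPPM sequence with 0 < α_k < ᾱ, ‖e_k‖ = 1, ‖z_k‖ = 1, such that for every k the interior of Ω_{k+1} is nonempty with F(x) ≺ F(x^{k+1}) for every x in that interior. Then {x^k} converges to a point x̄ which is a weak Pareto solution of the problem min{F(x) : x ∈ ℝⁿ}. -/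
open Filter Metric Set
open scoped Topology RealInnerProductSpace Pointwise

/-- The completeness assumption (H3) relative to the initial point `x0`. -/
def H3 {n m : ℕ} (F : Fin m → EuclideanSpace ℝ (Fin n) → ℝ)
    (x0 : EuclideanSpace ℝ (Fin n)) : Prop :=
  ∀ a : ℕ → EuclideanSpace ℝ (Fin n), a 0 = x0 →
    (∀ k, ∀ i, F i (a (k + 1)) ≤ F i (a k)) →
    ∃ b : EuclideanSpace ℝ (Fin n), ∀ k, ∀ i, F i b ≤ F i (a k)

section ConvexClarke

variable {n : ℕ} {f g : EuclideanSpace ℝ (Fin n) → ℝ} {D : Set (EuclideanSpace ℝ (Fin n))}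

lemma continuous_of_convexOn_univ (hf : ConvexOn ℝ univ f) : Continuous f :=
  continuousOn_univ.mp (hf.continuousOn isOpen_univ)

lemma diff_quotient_le_of_convexOn_univ (hf : ConvexOn ℝ univ f)
    (p d : EuclideanSpace ℝ (Fin n)) {t : ℝ} (ht : 0 < t) (ht1 : t ≤ 1) :
    (f (p + t • d) - f p) / t ≤ f (p + d) - f p := by
  have h := hf.2 (mem_univ p) (mem_univ (p + d)) (sub_nonneg.2 ht1) ht.le (by ring)
  have e : (1 - t) • p + t • (p + d) = p + t • d := by module
  rw [e, smul_eq_mul, smul_eq_mul] at h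
  rw [div_le_iff₀ ht]
  linarith

lemma le_diff_quotient_of_convexOn_univ (hf : ConvexOn ℝ univ f)
    (p d : EuclideanSpace ℝ (Fin n)) {t : ℝ} (ht : 0 < t) :
    f p - f (p - d) ≤ (f (p + t • d) - f p) / t := by
  have ht' : 0 < 1 + t := by linarith
  have ha : 0 ≤ t / (1 + t) := by positivity
  have hb : 0 ≤ 1 / (1 + t) := by positivity
  have h := hf.2 (mem_univ (p - d)) (mem_univ (p + t • d)) ha hb (by field_simp; ring)
  have e : (t / (1 + t)) • (p - d) + (1 / (1 + t)) • (p + t • d) = p := by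
    match_scalars <;> field_simp <;> ring
  rw [e, smul_eq_mul, smul_eq_mul] at h
  have h' : (1 + t) * f p ≤ t * f (p - d) + f (p + t • d) := by
    calc (1 + t) * f p
        ≤ (1 + t) * (t / (1 + t) * f (p - d) + 1 / (1 + t) * f (p + t • d)) := by gcongr
      _ = _ := by field_simp
  rw [le_div_iff₀ ht]
  linarith

/-- For a convex function, the Clarke directional derivative is bounded by increments. -/
lemma clarkeDeriv_le_of_convexOn_univ (hf : ConvexOn ℝ univ f)
    (x d : EuclideanSpace ℝ (Fin n)) : clarkeDeriv f x d ≤ f (x + d) - f x := by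
  have hc := continuous_of_convexOn_univ hf
  have hfst : Tendsto (Prod.fst : EuclideanSpace ℝ (Fin n) × ℝ → _)
      (𝓝 x ×ˢ 𝓝[>] (0 : ℝ)) (𝓝 x) := tendsto_fst
  have hsnd : ∀ᶠ p : EuclideanSpace ℝ (Fin n) × ℝ in 𝓝 x ×ˢ 𝓝[>] (0 : ℝ),
      p.2 ∈ Ioc (0 : ℝ) 1 :=
    tendsto_snd.eventually (Ioc_mem_nhdsGT one_pos)
  have hup : Tendsto (fun p : EuclideanSpace ℝ (Fin n) × ℝ => f (p.1 + d) - f p.1)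
      (𝓝 x ×ˢ 𝓝[>] (0 : ℝ)) (𝓝 (f (x + d) - f x)) :=
    (show Continuous fun y => f (y + d) - f y by fun_prop).continuousAt.tendsto.comp hfst
  have hlow : Tendsto (fun p : EuclideanSpace ℝ (Fin n) × ℝ => f p.1 - f (p.1 - d))
      (𝓝 x ×ˢ 𝓝[>] (0 : ℝ)) (𝓝 (f x - f (x - d))) :=
    (show Continuous fun y => f y - f (y - d) by fun_prop).continuousAt.tendsto.comp hfst
  have hcob : IsCoboundedUnder (· ≤ ·) (𝓝 x ×ˢ 𝓝[>] (0 : ℝ))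
      fun p : EuclideanSpace ℝ (Fin n) × ℝ => (f (p.1 + p.2 • d) - f p.1) / p.2 := by
    refine IsBoundedUnder.isCoboundedUnder_le
      (hlow.isBoundedUnder_ge.mono_ge ?_)
    filter_upwards [hsnd] with p hp
    exact le_diff_quotient_of_convexOn_univ hf p.1 d hp.1
  rw [← hup.limsup_eq]
  refine limsup_le_limsup ?_ hcob hup.isBoundedUnder_le
  filter_upwards [hsnd] with p hp
  exact diff_quotient_le_of_convexOn_univ hf p.1 d hp.1 hp.2

/-- The stationarity condition for a convex function on a set implies global minimality. -/
lemma le_of_zero_mem_clarkeSubdiff_add_normalCone (hf : ConvexOn ℝ univ f)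
    {x : EuclideanSpace ℝ (Fin n)} (h : 0 ∈ clarkeSubdiff f x + normalCone D x)
    {y : EuclideanSpace ℝ (Fin n)} (hy : y ∈ D) : f x ≤ f y := by
  obtain ⟨w, hw, v, hv, hwv⟩ := Set.mem_add.1 h
  have h1 := (hw (y - x)).trans (clarkeDeriv_le_of_convexOn_univ hf x (y - x))
  have h2 := hv y hy
  have h3 : ⟪w, y - x⟫ + ⟪v, y - x⟫ = 0 := by rw [← inner_add_left, hwv, inner_zero_left]
  rw [add_sub_cancel] at h1
  linarith

lemma nonneg_of_forall_nonneg_add_mul {P Q : ℝ}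
    (h : ∀ s ∈ Ioc (0 : ℝ) 1, 0 ≤ P + s * Q) : 0 ≤ P := by
  have ht : Tendsto (fun s : ℝ => P + s * Q) (𝓝[>] 0) (𝓝 P) := by
    have : Continuous fun s : ℝ => P + s * Q := by fun_prop
    simpa using (this.tendsto 0).mono_left nhdsWithin_le_nhds
  exact ge_of_tendsto ht (by filter_upwards [Ioc_mem_nhdsGT one_pos] with s hs using h s hs)

/-- The variational inequality satisfied by a constrained proximal point. -/
lemma proximal_inequality (hg : ConvexOn ℝ univ g) (hD : Convex ℝ D) {c : ℝ} (hc : 0 ≤ c)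
    {a x y : EuclideanSpace ℝ (Fin n)} (hx : x ∈ D) (hy : y ∈ D)
    (h : 0 ∈ clarkeSubdiff (fun u => g u + c / 2 * ‖u - a‖ ^ 2) x + normalCone D x) :
    g x ≤ g y + c * ⟪y - x, x - a⟫ := by
  have hsq : ConvexOn ℝ univ fun u : EuclideanSpace ℝ (Fin n) => c / 2 * ‖u - a‖ ^ 2 := by
    have h1 : ConvexOn ℝ univ fun u : EuclideanSpace ℝ (Fin n) => ‖u - a‖ := by
      simpa [dist_eq_norm] using convexOn_univ_dist a
    exact (h1.pow (fun _ _ => norm_nonneg _) 2).smul (by positivity : 0 ≤ c / 2)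
  have hconv := hg.add hsq
  suffices 0 ≤ (g y - g x + c * ⟪y - x, x - a⟫) by linarith
  refine nonneg_of_forall_nonneg_add_mul (Q := c / 2 * ‖y - x‖ ^ 2) fun s hs => ?_
  have e : (1 - s) • x + s • y = x + s • (y - x) := by module
  have hmem : x + s • (y - x) ∈ D := hD.add_smul_sub_mem hx hy ⟨hs.1.le, hs.2⟩
  have hmin := le_of_zero_mem_clarkeSubdiff_add_normalCone hconv h hmem
  have hgs := hg.2 (mem_univ x) (mem_univ y) (sub_nonneg.2 hs.2) hs.1.le (by ring)
  rw [e, smul_eq_mul, smul_eq_mul] at hgs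
  have e2 : x + s • (y - x) - a = (x - a) + s • (y - x) := by abel
  have hn : ‖x + s • (y - x) - a‖ ^ 2 =
      ‖x - a‖ ^ 2 + 2 * (s * ⟪y - x, x - a⟫) + s ^ 2 * ‖y - x‖ ^ 2 := by
    rw [e2, norm_add_sq_real, inner_smul_right, real_inner_comm, norm_smul, mul_pow,
      Real.norm_eq_abs, sq_abs]
  simp only [Pi.add_apply] at hmin
  rw [hn] at hmin
  refine nonneg_of_mul_nonneg_right ?_ hs.1
  linarith

end ConvexClarke

/-- A Fejér monotone sequence converges as soon as its cluster points lie in the target set. -/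
lemma exists_tendsto_of_fejer {X : Type*} [MetricSpace X] [ProperSpace X]
    {x : ℕ → X} {E : Set X} (hE : E.Nonempty)
    (hfejer : ∀ y ∈ E, Antitone fun k => dist (x k) y)
    (hcluster : ∀ a, ∀ φ : ℕ → ℕ, StrictMono φ → Tendsto (x ∘ φ) atTop (𝓝 a) → a ∈ E) :
    ∃ a ∈ E, Tendsto x atTop (𝓝 a) := by
  obtain ⟨b, hb⟩ := hE
  obtain ⟨a, -, φ, hφ, ha⟩ := tendsto_subseq_of_bounded
    (isBounded_closedBall (x := b) (r := dist (x 0) b))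
    (fun k => mem_closedBall.2 (hfejer b hb (Nat.zero_le k)))
  have haE := hcluster a φ hφ ha
  refine ⟨a, haE, tendsto_iff_dist_tendsto_zero.2 ?_⟩
  exact (tendsto_iff_tendsto_subseq_of_antitone (hfejer a haE) hφ.tendsto_atTop).2
    (tendsto_iff_dist_tendsto_zero.1 ha)

lemma norm_sub_le_of_inner_nonneg {V : Type*} [NormedAddCommGroup V] [InnerProductSpace ℝ V]
    {a x y : V} (h : 0 ≤ ⟪y - x, x - a⟫) : ‖x - y‖ ≤ ‖a - y‖ := by
  have e : a - y = (x - y) - (x - a) := by abel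
  have e' : ⟪x - y, x - a⟫ = -⟪y - x, x - a⟫ := by rw [← inner_neg_left, neg_sub]
  have h1 := norm_sub_sq_real (x - y) (x - a)
  rw [← e, e'] at h1
  exact le_of_sq_le_sq (by nlinarith [sq_nonneg ‖x - a‖]) (norm_nonneg _)

lemma EuclideanSpace.one_le_sum_of_norm_eq_one {m : ℕ} {z : EuclideanSpace ℝ (Fin m)}
    (hz : ∀ i, 0 ≤ z i) (hnz : ‖z‖ = 1) : 1 ≤ ∑ i, z i := by
  have h : ∑ i, z i ^ 2 = 1 := by rw [← EuclideanSpace.real_norm_sq_eq, hnz, one_pow]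
  rw [← h]
  refine Finset.sum_le_sum fun i _ => ?_
  have h1 : z i ^ 2 ≤ 1 := h ▸ Finset.single_le_sum (f := fun i => z i ^ 2)
    (fun j _ => sq_nonneg _) (Finset.mem_univ i)
  nlinarith [hz i]

lemma EuclideanSpace.sum_mul_pos {m : ℕ} {e z : EuclideanSpace ℝ (Fin m)}
    (he : ∀ i, 0 < e i) (hz : ∀ i, 0 ≤ z i) (hz0 : z ≠ 0) : 0 < ∑ i, e i * z i := by
  obtain ⟨i, hi⟩ : ∃ i, z i ≠ 0 := by
    by_contra! h
    exact hz0 (by ext i; simpa using h i)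
  exact Finset.sum_pos' (fun j _ => mul_nonneg (he j).le (hz j))
    ⟨i, Finset.mem_univ i, mul_pos (he i) ((hz i).lt_of_ne' hi)⟩

lemma EuclideanSpace.sum_mul_le_norm_mul_norm {m : ℕ} (e z : EuclideanSpace ℝ (Fin m)) :
    ∑ i, e i * z i ≤ ‖e‖ * ‖z‖ := by
  have h := real_inner_le_norm e z
  simpa [PiLp.inner_apply, mul_comm] using h

/-- When `F` is componentwise convex, the SPPM sequence converges to a weak Pareto
solution of `min {F(x) : x ∈ ℝⁿ}`. -/
theorem sppm_convex_weak_pareto {n m : ℕ} (F : Fin m → EuclideanSpace ℝ (Fin n) → ℝ)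
    (hconv : ∀ i, ∀ u v : EuclideanSpace ℝ (Fin n), ∀ t ∈ Set.Icc (0 : ℝ) 1,
      F i (t • u + (1 - t) • v) ≤ t * F i u + (1 - t) * F i v)
    (hpos : ∀ x i, 0 < F i x)
    (x : ℕ → EuclideanSpace ℝ (Fin n)) (α : ℕ → ℝ) (e z : ℕ → EuclideanSpace ℝ (Fin m))
    (hsppm : SPPMSeq F x α e z)
    (hH3 : H3 F (x 0))
    (αbar : ℝ) (hαbar : 0 < αbar) (hα : ∀ k, 0 < α k ∧ α k < αbar)
    (hne : ∀ k, ‖e k‖ = 1) (hnz : ∀ k, ‖z k‖ = 1)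
    (hint : ∀ k,
      (interior {y : EuclideanSpace ℝ (Fin n) | ∀ i, F i y ≤ F i (x (k + 1))}).Nonempty ∧
      ∀ y ∈ interior {y : EuclideanSpace ℝ (Fin n) | ∀ i, F i y ≤ F i (x (k + 1))},
        ∀ i, F i y < F i (x (k + 1))) :
    ∃ xbar : EuclideanSpace ℝ (Fin n), Tendsto x atTop (𝓝 xbar) ∧
      ¬ ∃ y : EuclideanSpace ℝ (Fin n), ∀ i, F i y < F i xbar := by
  obtain ⟨-, he, hz, hz0, hstep⟩ := hsppm
  have hF : ∀ i, ConvexOn ℝ univ (F i) := fun i => ⟨convex_univ, fun u _ v _ a b ha hb hab => by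
    obtain rfl : b = 1 - a := by linarith
    exact hconv i u v a ⟨ha, by linarith⟩⟩
  have hcont : ∀ i, Continuous (F i) := fun i => continuous_of_convexOn_univ (hF i)
  have hD : ∀ k, Convex ℝ {y | ∀ i, F i y ≤ F i (x k)} := fun k => by
    rw [ofPred_forall]
    exact convex_iInter fun i => by simpa using (hF i).convex_le (F i (x k))
  have hG : ∀ k, ConvexOn ℝ univ fun y => ∑ i, z k i * F i y := fun k => by
    refine ⟨convex_univ, fun u _ v _ a b ha hb hab => ?_⟩
    simp only [smul_eq_mul, Finset.mul_sum, ← Finset.sum_add_distrib]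
    refine Finset.sum_le_sum fun i _ => ?_
    have h := mul_le_mul_of_nonneg_left ((hF i).2 (mem_univ u) (mem_univ v) ha hb hab) (hz k i)
    simp only [smul_eq_mul] at h
    linarith
  have hβ : ∀ k, 0 < ∑ i, e k i * z k i := fun k =>
    EuclideanSpace.sum_mul_pos (he k) (hz k) (hz0 k)
  have hβ1 : ∀ k, ∑ i, e k i * z k i ≤ 1 := fun k => by
    simpa [hne k, hnz k] using EuclideanSpace.sum_mul_le_norm_mul_norm (e k) (z k)
  have hanti : ∀ i, Antitone fun k => F i (x k) := fun i =>
    antitone_nat_of_succ_le fun k => (hstep k).1 i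
  have hvi : ∀ y k, (∀ i, F i y ≤ F i (x k)) →
      ∑ i, z k i * F i (x (k + 1)) ≤ ∑ i, z k i * F i y +
        (α k * ∑ i, e k i * z k i) * ⟪y - x (k + 1), x (k + 1) - x k⟫ := fun y k hy => by
    have hc : α k * (∑ i, e k i * z k i) / 2 = α k / 2 * ∑ i, e k i * z k i := by ring
    refine proximal_inequality (g := fun y => ∑ i, z k i * F i y) (hG k) (hD k)
      (mul_pos (hα k).1 (hβ k)).le (hstep k).1 hy ?_
    rw [hc]
    exact (hstep k).2
  obtain ⟨a, haE, ha⟩ := exists_tendsto_of_fejer (x := x) (E := {y | ∀ k i, F i y ≤ F i (x k)})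
    (hH3 x rfl fun k => (hstep k).1)
    (fun y hy => antitone_nat_of_succ_le fun k => by
      rw [dist_eq_norm, dist_eq_norm]
      refine norm_sub_le_of_inner_nonneg ?_
      refine nonneg_of_mul_nonneg_right ?_ (mul_pos (hα k).1 (hβ k))
      have h1 : ∑ i, z k i * F i y ≤ ∑ i, z k i * F i (x (k + 1)) :=
        Finset.sum_le_sum fun i _ => mul_le_mul_of_nonneg_left (hy (k + 1) i) (hz k i)
      linarith [hvi y k (hy k)])
    (fun a φ hφ ha k i => by
      refine le_of_tendsto (((hcont i).tendsto a).comp ha) ?_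
      filter_upwards [eventually_ge_atTop k] with j hj
      exact hanti i (hj.trans (hφ.id_le j)))
  refine ⟨a, ha, ?_⟩
  rintro ⟨y, hy⟩
  have hyE : ∀ k i, F i y ≤ F i (x k) := fun k i => (hy i).le.trans (haE k i)
  obtain ⟨δ, hδ, hδF⟩ : ∃ δ > 0, ∀ i, F i y + δ ≤ F i a := by
    cases isEmpty_or_nonempty (Fin m) with
    | inl _ => exact ⟨1, one_pos, isEmptyElim⟩
    | inr _ =>
      obtain ⟨j, hj⟩ := Finite.exists_min fun i => F i a - F i y
      exact ⟨F j a - F j y, sub_pos.2 (hy j), fun i => by linarith [hj i]⟩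
  have hbound : ∀ k, δ ≤ αbar * (‖y - x (k + 1)‖ * ‖x (k + 1) - x k‖) := fun k => by
    have h1 : δ ≤ ∑ i, z k i * F i (x (k + 1)) - ∑ i, z k i * F i y := by
      calc δ ≤ (∑ i, z k i) * δ :=
            le_mul_of_one_le_left hδ.le (EuclideanSpace.one_le_sum_of_norm_eq_one (hz k) (hnz k))
        _ = ∑ i, z k i * δ := Finset.sum_mul _ _ _
        _ ≤ ∑ i, z k i * (F i (x (k + 1)) - F i y) :=
            Finset.sum_le_sum fun i _ => mul_le_mul_of_nonneg_left
              (by linarith [hδF i, haE (k + 1) i]) (hz k i)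
        _ = _ := by simp only [mul_sub, Finset.sum_sub_distrib]
    have h2 : α k * ∑ i, e k i * z k i ≤ αbar := by
      nlinarith [hα k, hβ k, hβ1 k]
    calc δ ≤ (α k * ∑ i, e k i * z k i) * ⟪y - x (k + 1), x (k + 1) - x k⟫ := by
            linarith [hvi y k (hyE k)]
      _ ≤ (α k * ∑ i, e k i * z k i) * (‖y - x (k + 1)‖ * ‖x (k + 1) - x k‖) :=
            mul_le_mul_of_nonneg_left (real_inner_le_norm _ _) (mul_pos (hα k).1 (hβ k)).le
      _ ≤ _ := by gcongr
  have ha' : Tendsto (fun k => x (k + 1)) atTop (𝓝 a) := ha.comp (tendsto_add_atTop_nat 1)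
  have hlim : Tendsto (fun k => αbar * (‖y - x (k + 1)‖ * ‖x (k + 1) - x k‖)) atTop (𝓝 0) := by
    simpa using ((ha'.const_sub y).norm.mul (ha'.sub ha).norm).const_mul αbar
  exact hδ.not_ge (ge_of_tendsto' hlim hbound)
end
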